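/- arXiv:1001.0556 — 2 statements merged into one kernel-verified Lean document; each statement's English description precedes it below -/
import Mathlib

section
/- Let m ≥ 2 be an integer and h > 0. For every γ ∈ ℤ the series ∑_{β∈ℤ} D_m[β]·G_m[γ−β] converges absolutely and h·∑_{β∈ℤ} D_m[β]·G_m[γ−β] = δ[γ], where δ[γ] = 1 if γ = 0 and δ[γ] = 0 otherwise. (That is, the function D_m defined by the explicit formula below is the discrete analogue of the differential operator d^{2m}/dx^{2m}.) -/
/-- The Euler–Frobenius coefficient `a_s^{(k)}`. -/
noncomputable def eulerCoeff (k s : ℕ) : ℝ :=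
  ∑ j ∈ Finset.range (s + 1),
    (-1 : ℝ) ^ j * (Nat.choose (k + 2) j : ℝ) * ((s + 1 - j : ℕ) : ℝ) ^ (k + 1)

/-- The Euler–Frobenius polynomial `E_k`. -/
noncomputable def eulerPoly (k : ℕ) : Polynomial ℝ :=
  ∑ s ∈ Finset.range (k + 1), Polynomial.C (eulerCoeff k s) * Polynomial.X ^ s

/-- The set `Λ` of real roots of `E_{2m-2}` of modulus less than `1`. -/
noncomputable def smallRoots (m : ℕ) : Finset ℝ :=
  (eulerPoly (2 * m - 2)).roots.toFinset.filter (fun x => |x| < 1)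

/-- The discrete analogue `D_m[β]` of the operator `d^{2m}/dx^{2m}`. -/
noncomputable def Dm (m : ℕ) (h : ℝ) (β : ℤ) : ℝ :=
  (((2 * m - 1).factorial : ℝ) / h ^ (2 * m)) *
    (if β = 0 then
      -(2 : ℝ) ^ (2 * m - 1) +
        ∑ l ∈ smallRoots m, (1 - l) ^ (2 * m + 1) / (l * (eulerPoly (2 * m - 1)).eval l)
    else if β.natAbs = 1 then
      1 + ∑ l ∈ smallRoots m, (1 - l) ^ (2 * m + 1) / (eulerPoly (2 * m - 1)).eval l
    else
      ∑ l ∈ smallRoots m,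
        (1 - l) ^ (2 * m + 1) * l ^ β.natAbs / (l * (eulerPoly (2 * m - 1)).eval l))

/-- The discrete function `G_m[β] = (hβ)^{2m-1} sign(β) / (2 (2m-1)!)`. -/
noncomputable def Gm (m : ℕ) (h : ℝ) (β : ℤ) : ℝ :=
  (h * (β : ℝ)) ^ (2 * m - 1) * (β.sign : ℝ) / (2 * ((2 * m - 1).factorial : ℝ))

section EulerFrobenius

open Polynomial

/-- The Euler–Frobenius polynomials, defined by their differential recurrence. -/
noncomputable def eulerRec : ℕ → ℝ[X]
  | 0 => 1
  | k + 1 => (1 + C ((k : ℝ) + 1) * X) * eulerRec k + X * (1 - X) * derivative (eulerRec k)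

lemma eulerRec_succ_eval (k : ℕ) (x : ℝ) :
    (eulerRec (k + 1)).eval x =
      (1 + (k + 1) * x) * (eulerRec k).eval x + x * (1 - x) * (derivative (eulerRec k)).eval x := by
  simp [eulerRec]

lemma natDegree_eulerRec_le (k : ℕ) : (eulerRec k).natDegree ≤ k := by
  induction k with
  | zero => simp [eulerRec]
  | succ k ih =>
    have hd : (derivative (eulerRec k)).natDegree ≤ k - 1 :=
      (natDegree_derivative_le _).trans (by omega)
    rcases Nat.eq_zero_or_pos k with rfl | hk
    · simp only [eulerRec, derivative_one, mul_zero, mul_one, add_zero]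
      compute_degree
    · rw [eulerRec]
      refine natDegree_add_le_of_degree_le ?_ ?_
      · refine (natDegree_mul_le_of_le (m := 1) (n := k) (by compute_degree) ih).trans (by omega)
      · refine (natDegree_mul_le_of_le (m := 2) (n := k - 1) (by compute_degree) hd).trans
          (by omega)

lemma coeff_eulerRec_self (k : ℕ) : (eulerRec k).coeff k = 1 := by
  induction k with
  | zero => simp [eulerRec]
  | succ k ih =>
    have h1 : (eulerRec k).coeff (k + 1) = 0 :=
      coeff_eq_zero_of_natDegree_lt (by have := natDegree_eulerRec_le k; omega)
    have e : eulerRec (k + 1) = eulerRec k + C ((k : ℝ) + 1) * (eulerRec k * X) +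
        derivative (eulerRec k) * X - derivative (eulerRec k) * X * X := by
      rw [eulerRec]; ring
    rw [e, coeff_sub, coeff_add, coeff_add, coeff_C_mul, coeff_mul_X, coeff_mul_X, coeff_mul_X,
      coeff_derivative, h1, ih]
    cases k with
    | zero => simp
    | succ k => rw [coeff_mul_X, coeff_derivative, ih]; push_cast; ring

lemma natDegree_eulerRec (k : ℕ) : (eulerRec k).natDegree = k :=
  le_antisymm (natDegree_eulerRec_le k)
    (le_natDegree_of_ne_zero (by rw [coeff_eulerRec_self]; exact one_ne_zero))

lemma monic_eulerRec (k : ℕ) : (eulerRec k).Monic := by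
  rw [Monic, leadingCoeff, natDegree_eulerRec, coeff_eulerRec_self]

lemma eval_zero_eulerRec (k : ℕ) : (eulerRec k).eval 0 = 1 := by
  induction k with
  | zero => simp [eulerRec]
  | succ k ih => rw [eulerRec_succ_eval, ih]; simp

/-- The Euler–Frobenius polynomials are palindromic. -/
lemma eulerRec_palindromic (k : ℕ) {x : ℝ} (hx : x ≠ 0) :
    x ^ k * (eulerRec k).eval x⁻¹ = (eulerRec k).eval x := by
  induction k generalizing x with
  | zero => simp [eulerRec]
  | succ k ih =>
    have h1 : HasDerivAt (fun y : ℝ => y ^ k * (eulerRec k).eval y⁻¹)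
        (k * x ^ (k - 1) * (eulerRec k).eval x⁻¹ +
          x ^ k * ((derivative (eulerRec k)).eval x⁻¹ * (-(x ^ 2)⁻¹))) x :=
      (hasDerivAt_pow k x).mul (((eulerRec k).hasDerivAt x⁻¹).comp x (hasDerivAt_inv hx))
    have h2 : HasDerivAt (fun y : ℝ => y ^ k * (eulerRec k).eval y⁻¹)
        ((derivative (eulerRec k)).eval x) x := by
      refine ((eulerRec k).hasDerivAt x).congr_of_eventuallyEq ?_
      filter_upwards [isOpen_ne.mem_nhds hx] with y hy using ih hy
    have h3 := h1.unique h2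
    have h4 := ih hx
    rw [eulerRec_succ_eval, eulerRec_succ_eval, ← h3, ← h4]
    cases k with
    | zero => simp; field_simp; ring
    | succ k =>
      simp only [Nat.add_sub_cancel]
      push_cast
      field_simp
      ring

/-- The power series `∑ n ^ k X ^ n`. -/
noncomputable def powSeries (k : ℕ) : PowerSeries ℝ := PowerSeries.mk fun n => (n : ℝ) ^ k

lemma powSeries_succ (k : ℕ) :
    powSeries (k + 1) = PowerSeries.X * PowerSeries.derivative ℝ (powSeries k) := by
  ext n
  cases n with
  | zero => simp [powSeries]
  | succ n =>
    rw [PowerSeries.coeff_succ_X_mul, PowerSeries.coeff_derivative]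
    simp only [powSeries, PowerSeries.coeff_mk]
    push_cast
    ring

lemma one_sub_X_pow_mul_powSeries (k : ℕ) :
    (1 - PowerSeries.X) ^ (k + 2) * powSeries (k + 1) =
      ((X * eulerRec k : ℝ[X]) : PowerSeries ℝ) := by
  induction k with
  | zero =>
    have h0 : (1 - PowerSeries.X) * powSeries 0 = 1 := by
      rw [mul_comm]
      convert PowerSeries.mk_one_mul_one_sub_eq_one ℝ using 2
      ext n
      simp [powSeries]
    have h1 := congrArg (PowerSeries.derivative ℝ) h0
    rw [Derivation.leibniz, map_sub, PowerSeries.derivative_one, PowerSeries.derivative_X] at h1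
    simp only [smul_eq_mul] at h1
    rw [powSeries_succ]
    simp only [eulerRec, mul_one, Polynomial.coe_X]
    linear_combination PowerSeries.X * (1 - PowerSeries.X) * h1 + PowerSeries.X * h0
  | succ k ih =>
    have h1 := congrArg (PowerSeries.derivative ℝ) ih
    rw [Derivation.leibniz, PowerSeries.derivative_pow, map_sub, PowerSeries.derivative_one,
      PowerSeries.derivative_X, PowerSeries.derivative_coe] at h1
    simp only [smul_eq_mul, derivative_mul, derivative_X, Polynomial.coe_mul, Polynomial.coe_add,
      Polynomial.coe_X, one_mul] at h1 ih
    rw [powSeries_succ (k + 1)]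
    simp only [eulerRec, Polynomial.coe_mul, Polynomial.coe_add, Polynomial.coe_sub,
      Polynomial.coe_X, Polynomial.coe_one, Polynomial.coe_C]
    have hc : PowerSeries.C ((k : ℝ) + 1) = (k : PowerSeries ℝ) + 1 := by simp
    rw [hc]
    rw [show k + 2 - 1 = k + 1 by omega] at h1
    push_cast at h1
    linear_combination PowerSeries.X * (1 - PowerSeries.X) * h1 +
      PowerSeries.X * ((k : PowerSeries ℝ) + 2) * ih

lemma coeff_one_sub_X_pow (d n : ℕ) :
    PowerSeries.coeff n ((1 - PowerSeries.X : PowerSeries ℝ) ^ d) = (-1) ^ n * (d.choose n : ℝ) := by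
  have h : ((1 - PowerSeries.X : PowerSeries ℝ) ^ d) =
      ((((1 + X) ^ d).comp (C (-1) * X) : ℝ[X]) : PowerSeries ℝ) := by
    rw [pow_comp, Polynomial.coe_pow]
    congr 1
    simp [sub_eq_add_neg]
  rw [h, Polynomial.coeff_coe, comp_C_mul_X_coeff, coeff_one_add_X_pow, mul_comm]

lemma coeff_eulerRec (k s : ℕ) : (eulerRec k).coeff s = eulerCoeff k s := by
  have h := congrArg (PowerSeries.coeff (s + 1)) (one_sub_X_pow_mul_powSeries k)
  rw [Polynomial.coeff_coe, coeff_X_mul, PowerSeries.coeff_mul,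
    Finset.Nat.sum_antidiagonal_eq_sum_range_succ_mk, Finset.sum_range_succ] at h
  rw [← h, eulerCoeff]
  simp only [powSeries, PowerSeries.coeff_mk, coeff_one_sub_X_pow]
  simp

lemma eulerPoly_eq_eulerRec (k : ℕ) : eulerPoly k = eulerRec k := by
  rw [eulerPoly, (eulerRec k).as_sum_range_C_mul_X_pow, natDegree_eulerRec]
  simp only [coeff_eulerRec]

lemma hasSum_coeff_one_sub_X_mul {F : PowerSeries ℝ} {x a : ℝ}
    (h : HasSum (fun n => PowerSeries.coeff n F * x ^ n) a) :
    HasSum (fun n => PowerSeries.coeff n ((1 - PowerSeries.X) * F) * x ^ n) ((1 - x) * a) := by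
  have h0 : HasSum (fun n => PowerSeries.coeff (n + 1) (PowerSeries.X * F) * x ^ (n + 1))
      (x * a) := by
    have e : (fun n => PowerSeries.coeff (n + 1) (PowerSeries.X * F) * x ^ (n + 1)) =
        fun n => x * (PowerSeries.coeff n F * x ^ n) := by
      funext n
      rw [PowerSeries.coeff_succ_X_mul]
      ring
    rw [e]
    exact h.mul_left x
  have h1 : HasSum (fun n => PowerSeries.coeff n (PowerSeries.X * F) * x ^ n) (x * a) := by
    have h2 := (hasSum_nat_add_iff
      (f := fun n => PowerSeries.coeff n (PowerSeries.X * F) * x ^ n) 1).1 h0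
    simpa using h2
  have h2 := h.sub h1
  simpa only [sub_mul, one_mul, map_sub] using h2

lemma hasSum_coeff_one_sub_X_pow_mul {F : PowerSeries ℝ} {x a : ℝ}
    (h : HasSum (fun n => PowerSeries.coeff n F * x ^ n) a) (d : ℕ) :
    HasSum (fun n => PowerSeries.coeff n ((1 - PowerSeries.X) ^ d * F) * x ^ n)
      ((1 - x) ^ d * a) := by
  induction d with
  | zero => simpa using h
  | succ d ih =>
    convert hasSum_coeff_one_sub_X_mul ih using 1
    · simp only [pow_succ', mul_assoc]
    · ring

lemma hasSum_coeff_polynomial (p : ℝ[X]) (x : ℝ) :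
    HasSum (fun n => PowerSeries.coeff n (p : PowerSeries ℝ) * x ^ n) (p.eval x) := by
  rw [eval_eq_sum_range]
  simp only [Polynomial.coeff_coe]
  refine hasSum_sum_of_ne_finset_zero fun n hn => ?_
  rw [coeff_eq_zero_of_natDegree_lt (by simpa using hn), zero_mul]

/-- The generating function of the powers `n ^ (k + 1)`. -/
lemma hasSum_pow_mul_geometric_eulerRec (k : ℕ) {x : ℝ} (hx : |x| < 1) :
    HasSum (fun n : ℕ => (n : ℝ) ^ (k + 1) * x ^ n)
      (x * (eulerRec k).eval x / (1 - x) ^ (k + 2)) := by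
  have hs := (summable_pow_mul_geometric_of_norm_lt_one (k + 1) (r := x) hx).hasSum
  have h1 := hasSum_coeff_one_sub_X_pow_mul (F := powSeries (k + 1)) (x := x)
    (by simpa [powSeries] using hs) (k + 2)
  rw [one_sub_X_pow_mul_powSeries] at h1
  have h2 := h1.unique (hasSum_coeff_polynomial _ x)
  have h3 : (1 - x) ^ (k + 2) ≠ 0 := pow_ne_zero _ (by linarith [(abs_lt.1 hx).2])
  rw [eval_mul, eval_X] at h2
  rwa [← h2, mul_div_cancel_left₀ _ h3]

/-- The polynomials giving `∑ n ^ (k + 1) x ^ n` in terms of `y = x / (1 - x)`. -/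
noncomputable def fubiniPoly : ℕ → ℝ[X]
  | 0 => X * (1 + X)
  | k + 1 => X * (1 + X) * derivative (fubiniPoly k)

lemma fubiniPoly_eval (k : ℕ) {y : ℝ} (hy : 1 + y ≠ 0) :
    (fubiniPoly k).eval y = y * (1 + y) ^ (k + 1) * (eulerRec k).eval (y / (1 + y)) := by
  induction k generalizing y with
  | zero => simp [fubiniPoly, eulerRec]
  | succ k ih =>
    have hq : HasDerivAt (fun z : ℝ => z / (1 + z)) ((1 * (1 + y) - y * 1) / (1 + y) ^ 2) y :=
      (hasDerivAt_id y).div ((hasDerivAt_id y).const_add 1) hy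
    have hp : HasDerivAt (fun z : ℝ => (1 + z) ^ (k + 1)) (((k + 1 : ℕ) : ℝ) * (1 + y) ^ k * 1) y :=
      ((hasDerivAt_id y).const_add 1).pow (k + 1)
    have h1 := ((hasDerivAt_id y).mul hp).mul (((eulerRec k).hasDerivAt (y / (1 + y))).comp y hq)
    have h2 : HasDerivAt (fun z : ℝ => z * (1 + z) ^ (k + 1) * (eulerRec k).eval (z / (1 + z)))
        ((derivative (fubiniPoly k)).eval y) y := by
      refine ((fubiniPoly k).hasDerivAt y).congr_of_eventuallyEq ?_
      have ho : IsOpen {z : ℝ | 1 + z ≠ 0} :=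
        isOpen_ne_fun (by fun_prop) continuous_const
      filter_upwards [ho.mem_nhds hy] with z hz using (ih hz).symm
    have h3 := h2.unique h1
    rw [fubiniPoly, eval_mul, h3, eulerRec_succ_eval]
    simp
    field_simp
    ring

lemma card_roots_fubiniPoly (k : ℕ) :
    fubiniPoly k ≠ 0 ∧ (fubiniPoly k).eval 0 = 0 ∧ (fubiniPoly k).eval (-1) = 0 ∧
      k + 2 ≤ (fubiniPoly k).roots.toFinset.card := by
  have step : ∀ q : ℝ[X], q ≠ 0 → X * (1 + X) * q ≠ 0 ∧ (X * (1 + X) * q).eval 0 = 0 ∧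
      (X * (1 + X) * q).eval (-1) = 0 ∧
      ∀ s ⊆ q.roots.toFinset, 0 ∉ s → -1 ∉ s →
        s.card + 2 ≤ (X * (1 + X) * q).roots.toFinset.card := by
    intro q hq
    have h1 : (1 + X : ℝ[X]) ≠ 0 := by
      rw [add_comm, ← C_1]; exact X_add_C_ne_zero 1
    have h0 : X * (1 + X) * q ≠ 0 := mul_ne_zero (mul_ne_zero X_ne_zero h1) hq
    refine ⟨h0, by simp, by simp, fun s hs hs0 hs1 => ?_⟩
    have hc : (insert 0 (insert (-1) s)).card = s.card + 2 := by
      rw [Finset.card_insert_of_notMem (by simp [hs0]), Finset.card_insert_of_notMem hs1]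
    rw [← hc]
    refine Finset.card_le_card fun x hx => ?_
    rw [Multiset.mem_toFinset, mem_roots h0, IsRoot]
    simp only [Finset.mem_insert] at hx
    rcases hx with rfl | rfl | hx
    · simp
    · simp
    · have := hs hx
      rw [Multiset.mem_toFinset, mem_roots hq, IsRoot] at this
      simp [this]
  induction k with
  | zero =>
    obtain ⟨h1, h2, h3, h4⟩ := step 1 one_ne_zero
    rw [mul_one] at h1 h2 h3 h4
    exact ⟨h1, h2, h3, h4 ∅ (by simp) (by simp) (by simp)⟩
  | succ k ih =>
    obtain ⟨i1, i2, i3, i4⟩ := ih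
    have hr := card_roots_toFinset_le_card_roots_derivative_sdiff_roots_succ (fubiniPoly k)
    have hd : derivative (fubiniPoly k) ≠ 0 := by
      intro h
      rw [h] at hr
      simp at hr
      omega
    obtain ⟨h1, h2, h3, h4⟩ := step _ hd
    refine ⟨h1, h2, h3, le_trans ?_ 
      (h4 _ (Finset.sdiff_subset (t := (fubiniPoly k).roots.toFinset)) ?_ ?_)⟩
    · omega
    · simp [i1, i2]
    · simp [i1, i3]

lemma card_roots_eulerRec (k : ℕ) : (eulerRec k).roots.toFinset.card = k := by
  have hne := (monic_eulerRec k).ne_zero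
  refine le_antisymm ?_ ?_
  · calc _ ≤ _ := Multiset.toFinset_card_le _
      _ ≤ _ := card_roots' _
      _ = k := natDegree_eulerRec k
  · obtain ⟨h1, h2, h3, h4⟩ := card_roots_fubiniPoly k
    set s := ((fubiniPoly k).roots.toFinset.erase 0).erase (-1)
    have hs : k ≤ s.card := by
      have e1 : _ ≤ ((fubiniPoly k).roots.toFinset.erase 0).card :=
        Finset.pred_card_le_card_erase
      have e2 : _ ≤ s.card := Finset.pred_card_le_card_erase
      omega
    refine hs.trans (Finset.card_le_card_of_injOn (fun y => y / (1 + y)) ?_ ?_)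
    · intro y hy
      simp only [s, Finset.coe_erase, Set.mem_sdiff, Finset.mem_coe, Multiset.mem_toFinset,
        mem_roots h1, IsRoot, Set.mem_singleton_iff] at hy
      obtain ⟨⟨hy, hy0⟩, hy1⟩ := hy
      have hy2 : 1 + y ≠ 0 := fun h => hy1 (by linarith)
      rw [fubiniPoly_eval k hy2] at hy
      simp only [Finset.mem_coe, Multiset.mem_toFinset, mem_roots hne, IsRoot]
      simpa [hy0, hy2] using hy
    · intro y hy z hz hyz
      have hy1 : y ≠ -1 := by simp [s] at hy; tauto
      have hz1 : z ≠ -1 := by simp [s] at hz; tauto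
      have hy2 : 1 + y ≠ 0 := fun h => hy1 (by linarith)
      have hz2 : 1 + z ≠ 0 := fun h => hz1 (by linarith)
      simp only at hyz
      field_simp at hyz
      linarith

lemma mem_roots_eulerRec {k : ℕ} {l : ℝ} :
    l ∈ (eulerRec k).roots.toFinset ↔ (eulerRec k).eval l = 0 := by
  rw [Multiset.mem_toFinset, mem_roots (monic_eulerRec k).ne_zero, IsRoot]

lemma nodal_roots_eulerRec (k : ℕ) :
    Lagrange.nodal (eulerRec k).roots.toFinset id = eulerRec k := by
  have h1 : (eulerRec k).roots.toFinset.card = (eulerRec k).roots.card := by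
    refine le_antisymm (Multiset.toFinset_card_le _) ?_
    rw [card_roots_eulerRec]
    exact (card_roots' _).trans (natDegree_eulerRec k).le
  have h2 := Multiset.toFinset_card_eq_card_iff_nodup.1 h1
  rw [Lagrange.nodal, Finset.prod, Multiset.toFinset_val, h2.dedup]
  exact prod_multiset_X_sub_C_of_monic_of_roots_card_eq (monic_eulerRec k)
    (by rw [← h1, card_roots_eulerRec, natDegree_eulerRec])

lemma eval_one_eulerRec_ne_zero (k : ℕ) : (eulerRec k).eval 1 ≠ 0 := by
  induction k with
  | zero => simp [eulerRec]
  | succ k ih =>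
    rw [eulerRec_succ_eval, sub_self, mul_zero, zero_mul, add_zero]
    exact mul_ne_zero (by positivity) ih

lemma derivative_eulerRec_ne_zero {k : ℕ} {l : ℝ} (hl : (eulerRec k).eval l = 0) :
    (derivative (eulerRec k)).eval l ≠ 0 := by
  have hm := mem_roots_eulerRec.2 hl
  have h := Lagrange.eval_nodal_derivative_eval_node_eq (v := (id : ℝ → ℝ)) hm
  rw [nodal_roots_eulerRec, Lagrange.eval_nodal] at h
  simp only [id] at h
  rw [h, Finset.prod_ne_zero_iff]
  exact fun j hj => sub_ne_zero.2 (Finset.ne_of_mem_erase hj).symm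

lemma root_eulerRec_ne_zero {k : ℕ} {l : ℝ} (hl : (eulerRec k).eval l = 0) : l ≠ 0 := by
  rintro rfl
  rw [eval_zero_eulerRec] at hl
  exact one_ne_zero hl

lemma root_eulerRec_ne_one {k : ℕ} {l : ℝ} (hl : (eulerRec k).eval l = 0) : l ≠ 1 := by
  rintro rfl
  exact eval_one_eulerRec_ne_zero k hl

lemma eval_succ_root_eulerRec {k : ℕ} {l : ℝ} (hl : (eulerRec k).eval l = 0) :
    (eulerRec (k + 1)).eval l = l * (1 - l) * (derivative (eulerRec k)).eval l := by
  rw [eulerRec_succ_eval, hl, mul_zero, zero_add]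

lemma eval_succ_root_eulerRec_ne_zero {k : ℕ} {l : ℝ} (hl : (eulerRec k).eval l = 0) :
    (eulerRec (k + 1)).eval l ≠ 0 := by
  rw [eval_succ_root_eulerRec hl]
  exact mul_ne_zero (mul_ne_zero (root_eulerRec_ne_zero hl)
    (sub_ne_zero.2 (root_eulerRec_ne_one hl).symm)) (derivative_eulerRec_ne_zero hl)

lemma root_eulerRec_inv {k : ℕ} {l : ℝ} (hl : (eulerRec k).eval l = 0) :
    (eulerRec k).eval l⁻¹ = 0 := by
  have h0 := root_eulerRec_ne_zero hl
  have h := eulerRec_palindromic k h0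
  rw [hl] at h
  exact (mul_eq_zero.1 h).resolve_left (pow_ne_zero _ h0)

lemma root_eulerRec_ne_neg_one {p : ℕ} {l : ℝ} (hl : (eulerRec (2 * p)).eval l = 0) :
    l ≠ -1 := by
  rintro rfl
  have h := eulerRec_palindromic (2 * p + 1) (x := -1) (by norm_num)
  rw [Odd.neg_one_pow ⟨p, rfl⟩, show (-1 : ℝ)⁻¹ = -1 by norm_num] at h
  exact eval_succ_root_eulerRec_ne_zero hl (by linarith)

lemma sum_roots_eulerRec {k : ℕ} {g : ℝ[X]} (hg : g.natDegree ≤ k) :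
    ∑ l ∈ (eulerRec k).roots.toFinset, g.eval l / (l * (derivative (eulerRec k)).eval l) =
      g.coeff k - g.eval 0 := by
  set Z := (eulerRec k).roots.toFinset with hZ
  have h0 : (0 : ℝ) ∉ Z := fun h => root_eulerRec_ne_zero (mem_roots_eulerRec.1 h) rfl
  have hnod : Lagrange.nodal (insert 0 Z) id = X * eulerRec k := by
    rw [Lagrange.nodal_insert_eq_nodal h0, hZ, nodal_roots_eulerRec]
    simp
  have hprod : ∀ l ∈ insert 0 Z, ∏ j ∈ (insert 0 Z).erase l, (l - j) =
      (eulerRec k).eval l + l * (derivative (eulerRec k)).eval l := by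
    intro l hl
    have h := Lagrange.eval_nodal_derivative_eval_node_eq (v := (id : ℝ → ℝ)) hl
    rw [hnod, Lagrange.eval_nodal] at h
    simp only [id] at h
    rw [← h]
    simp
  have hcard : (insert 0 Z).card = k + 1 := by
    rw [Finset.card_insert_of_notMem h0, hZ, card_roots_eulerRec]
  have h := Lagrange.coeff_eq_sum (s := insert 0 Z) (v := (id : ℝ → ℝ)) Function.injective_id.injOn
    (P := g) (by
      rw [hcard]
      exact lt_of_le_of_lt degree_le_natDegree (by exact_mod_cast Nat.lt_succ_of_le hg))
  simp only [id] at h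
  rw [Finset.sum_congr rfl fun l hl => by rw [hprod l hl], Finset.sum_insert h0, hcard,
    Nat.add_sub_cancel, eval_zero_eulerRec] at h
  rw [h, zero_mul, add_zero, div_one, add_sub_cancel_left]
  refine Finset.sum_congr rfl fun l hl => ?_
  rw [mem_roots_eulerRec.1 hl, zero_add]

/-- The roots of `eulerRec k` inside the unit disc. -/
noncomputable def innerRoots (k : ℕ) : Finset ℝ :=
  (eulerRec k).roots.toFinset.filter (fun x => |x| < 1)

lemma mem_innerRoots {k : ℕ} {l : ℝ} : l ∈ innerRoots k ↔ (eulerRec k).eval l = 0 ∧ |l| < 1 := by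
  rw [innerRoots, Finset.mem_filter, mem_roots_eulerRec]

lemma sum_all_roots {p q : ℕ} (hq : Odd q) (hqp : q ≤ 2 * p) :
    ∑ l ∈ (eulerRec (2 * p)).roots.toFinset,
      (1 - l) ^ (2 * p + 1 - q) * (eulerRec q).eval l / (eulerRec (2 * p + 1)).eval l = -2 := by
  have hd1 : ((1 - X : ℝ[X]) ^ (2 * p - q)).natDegree ≤ 2 * p - q := by
    compute_degree
  have hg : ((1 - X : ℝ[X]) ^ (2 * p - q) * eulerRec q).natDegree ≤ 2 * p :=
    (natDegree_mul_le_of_le hd1 (natDegree_eulerRec_le q)).trans (by omega)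
  have hc : ((1 - X : ℝ[X]) ^ (2 * p - q) * eulerRec q).coeff (2 * p) = -1 := by
    have hodd : Odd (2 * p - q) := Nat.Even.sub_odd hqp (even_two_mul p) hq
    have h1 : (1 - X : ℝ[X]) ^ (2 * p - q) = -(X - C 1) ^ (2 * p - q) := by
      rw [← hodd.neg_pow, C_1, neg_sub]
    rw [h1, neg_mul, coeff_neg]
    have h2 : ((X - C (1 : ℝ)) ^ (2 * p - q) * eulerRec q).Monic :=
      ((monic_X_sub_C 1).pow _).mul (monic_eulerRec q)
    have h3 : ((X - C (1 : ℝ)) ^ (2 * p - q) * eulerRec q).natDegree = 2 * p := by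
      rw [((monic_X_sub_C (1 : ℝ)).pow _).natDegree_mul (monic_eulerRec q), natDegree_pow,
        natDegree_X_sub_C, natDegree_eulerRec]
      omega
    have h4 := h2.coeff_natDegree
    rw [h3] at h4
    rw [h4]
  have h := sum_roots_eulerRec hg
  rw [hc, eval_mul, eval_zero_eulerRec] at h
  refine (Finset.sum_congr rfl fun l hl => ?_).trans (h.trans (by simp; norm_num))
  have hl := mem_roots_eulerRec.1 hl
  have h1 : 1 - l ≠ 0 := sub_ne_zero.2 (root_eulerRec_ne_one hl).symm
  have h2 := root_eulerRec_ne_zero hl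
  have h3 := derivative_eulerRec_ne_zero hl
  rw [eval_succ_root_eulerRec hl, show 2 * p + 1 - q = 2 * p - q + 1 by omega]
  simp only [eval_mul, eval_pow, eval_sub, eval_one, eval_X]
  field_simp
  ring

lemma sum_innerRoots {p q : ℕ} (hq : Odd q) (hqp : q ≤ 2 * p) :
    ∑ l ∈ innerRoots (2 * p),
      (1 - l) ^ (2 * p + 1 - q) * (eulerRec q).eval l / (eulerRec (2 * p + 1)).eval l = -1 := by
  have h := sum_all_roots hq hqp
  rw [← Finset.sum_filter_add_sum_filter_not _ (fun x : ℝ => |x| < 1)] at h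
  have h2 : ∑ l ∈ (eulerRec (2 * p)).roots.toFinset with ¬ |l| < 1,
      (1 - l) ^ (2 * p + 1 - q) * (eulerRec q).eval l / (eulerRec (2 * p + 1)).eval l =
      ∑ l ∈ (eulerRec (2 * p)).roots.toFinset with |l| < 1,
      (1 - l) ^ (2 * p + 1 - q) * (eulerRec q).eval l / (eulerRec (2 * p + 1)).eval l := by
    refine Finset.sum_bij' (fun l _ => l⁻¹) (fun l _ => l⁻¹) ?_ ?_ ?_ ?_ ?_
    · intro l hl
      rw [Finset.mem_filter, mem_roots_eulerRec, not_lt] at hl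
      rw [Finset.mem_filter, mem_roots_eulerRec]
      refine ⟨root_eulerRec_inv hl.1, ?_⟩
      rw [abs_inv]
      refine inv_lt_one_of_one_lt₀ (lt_of_le_of_ne hl.2 fun h1 => ?_)
      rcases eq_or_eq_neg_of_abs_eq h1.symm with h2 | h2
      · exact root_eulerRec_ne_one hl.1 h2
      · exact root_eulerRec_ne_neg_one hl.1 h2
    · intro l hl
      rw [Finset.mem_filter, mem_roots_eulerRec] at hl
      rw [Finset.mem_filter, mem_roots_eulerRec, not_lt, abs_inv]
      exact ⟨root_eulerRec_inv hl.1,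
        (one_lt_inv₀ (abs_pos.2 (root_eulerRec_ne_zero hl.1))).2 hl.2 |>.le⟩
    · simp
    · simp
    · intro l hl
      rw [Finset.mem_filter, mem_roots_eulerRec] at hl
      have h0 := root_eulerRec_ne_zero hl.1
      have h1 := eval_succ_root_eulerRec_ne_zero hl.1
      have h1' := eval_succ_root_eulerRec_ne_zero (root_eulerRec_inv hl.1)
      have e1 := eulerRec_palindromic q h0
      have e2 := eulerRec_palindromic (2 * p + 1) h0
      have e3 : (1 - l) ^ (2 * p + 1 - q) = l ^ (2 * p + 1 - q) * (1 - l⁻¹) ^ (2 * p + 1 - q) := by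
        have hev : Even (2 * p + 1 - q) := Nat.Odd.sub_odd (odd_two_mul_add_one p) hq
        rw [← mul_pow, mul_sub, mul_one, mul_inv_cancel₀ h0, ← hev.neg_pow, neg_sub]
      have e4 : l ^ (2 * p + 1) = l ^ (2 * p + 1 - q) * l ^ q := by
        rw [← pow_add]
        congr 1
        omega
      rw [← e1, ← e2, e3, e4]
      field_simp
  rw [h2] at h
  rw [innerRoots]
  linarith

/-- The weight of the root `l` in the discrete differential operator. -/
noncomputable def rootWeight (p : ℕ) (l : ℝ) : ℝ :=
  (1 - l) ^ (2 * p + 3) / (l * (eulerRec (2 * p + 1)).eval l)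

/-- The finitely supported part of the discrete differential operator. -/
noncomputable def stencilCore (p : ℕ) (β : ℤ) : ℝ :=
  if β = 0 then -(2 : ℝ) ^ (2 * p + 1) else if β.natAbs = 1 then 1 else 0

/-- The discrete differential operator of order `2 * (p + 1)`, up to normalisation. -/
noncomputable def stencil (p : ℕ) (β : ℤ) : ℝ :=
  ∑ l ∈ innerRoots (2 * p), rootWeight p l * l ^ β.natAbs + stencilCore p β

lemma stencil_neg (p : ℕ) (β : ℤ) : stencil p (-β) = stencil p β := by
  simp [stencil, stencilCore]

lemma Dm_eq_stencil (p : ℕ) (h : ℝ) (β : ℤ) :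
    Dm (p + 1) h β = ((2 * p + 1).factorial : ℝ) / h ^ (2 * p + 2) * stencil p β := by
  have e1 : 2 * (p + 1) - 1 = 2 * p + 1 := by omega
  have e2 : 2 * (p + 1) - 2 = 2 * p := by omega
  have e3 : smallRoots (p + 1) = innerRoots (2 * p) := by
    rw [smallRoots, innerRoots, e2, eulerPoly_eq_eulerRec]
  rw [Dm, e1, e3, eulerPoly_eq_eulerRec, stencil, stencilCore]
  congr 1
  simp only [rootWeight]
  split_ifs with h1 h2
  · subst h1
    simp only [Int.natAbs_zero, pow_zero, mul_one]
    rw [add_comm]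
    rfl
  · rw [h2, add_comm]
    congr 1
    refine Finset.sum_congr rfl fun l hl => ?_
    have := root_eulerRec_ne_zero (mem_innerRoots.1 hl).1
    rw [pow_one, show 2 * (p + 1) + 1 = 2 * p + 3 by ring]
    field_simp
  · rw [add_zero]
    refine Finset.sum_congr rfl fun l _ => ?_
    rw [show 2 * (p + 1) + 1 = 2 * p + 3 by ring]
    ring

lemma hasSum_pow_mul_innerRoot {p : ℕ} {l : ℝ} (hl : l ∈ innerRoots (2 * p)) :
    HasSum (fun n : ℕ => (n : ℝ) ^ (2 * p + 1) * l ^ n) 0 := by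
  obtain ⟨h1, h2⟩ := mem_innerRoots.1 hl
  simpa [h1] using hasSum_pow_mul_geometric_eulerRec (2 * p) h2

lemma hasSum_stencil_add_mul_pow (p c : ℕ) :
    HasSum (fun n : ℕ => stencil p (c + n) * (n : ℝ) ^ (2 * p + 1)) (if c = 0 then 1 else 0) := by
  have h1 : HasSum (fun n : ℕ => ∑ l ∈ innerRoots (2 * p),
      rootWeight p l * l ^ c * ((n : ℝ) ^ (2 * p + 1) * l ^ n)) 0 := by
    have := hasSum_sum (s := innerRoots (2 * p)) fun l hl =>
      (hasSum_pow_mul_innerRoot hl).mul_left (rootWeight p l * l ^ c)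
    simpa using this
  have h2 : HasSum (fun n : ℕ => stencilCore p (c + n) * (n : ℝ) ^ (2 * p + 1))
      (if c = 0 then 1 else 0) := by
    have h3 := hasSum_single (f := fun n : ℕ => stencilCore p (c + n) * (n : ℝ) ^ (2 * p + 1)) 1
      (by
        intro n hn
        rcases Nat.eq_zero_or_pos n with rfl | hn0
        · simp
        · have a1 : (c : ℤ) + n ≠ 0 := by omega
          have a2 : ((c : ℤ) + n).natAbs ≠ 1 := by omega
          simp [stencilCore, a1, a2])
    convert h3 using 1
    rcases Nat.eq_zero_or_pos c with rfl | hc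
    · simp [stencilCore]
    · have a1 : (c : ℤ) + 1 ≠ 0 := by omega
      have a2 : ((c : ℤ) + 1).natAbs ≠ 1 := by omega
      simp [stencilCore, a1, a2, hc.ne']
  have h3 := h1.add h2
  rw [zero_add] at h3
  refine h3.congr_fun fun n => ?_
  rw [stencil, add_mul, Finset.sum_mul]
  congr 1
  refine Finset.sum_congr rfl fun l _ => ?_
  rw [show ((c : ℤ) + n).natAbs = c + n by omega, pow_add]
  ring

lemma hasSum_stencil_mul_succ_pow (p : ℕ) :
    HasSum (fun n : ℕ => stencil p n * ((n : ℝ) + 1) ^ (2 * p + 1)) 0 := by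
  have h1 : HasSum (fun n : ℕ => ∑ l ∈ innerRoots (2 * p),
      rootWeight p l / l * (((n + 1 : ℕ) : ℝ) ^ (2 * p + 1) * l ^ (n + 1))) 0 := by
    rw [← Finset.sum_const_zero (s := innerRoots (2 * p))]
    refine hasSum_sum fun l hl => ?_
    have h := (hasSum_nat_add_iff' 1).2 (hasSum_pow_mul_innerRoot hl)
    rw [Finset.sum_range_one, Nat.cast_zero, zero_pow (by omega), zero_mul, sub_zero] at h
    simpa using h.mul_left (rootWeight p l / l)
  have h2 : HasSum (fun n : ℕ => stencilCore p n * ((n : ℝ) + 1) ^ (2 * p + 1)) 0 := by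
    have h3 := hasSum_sum_of_ne_finset_zero
      (L := SummationFilter.unconditional ℕ) (s := Finset.range 2)
      (f := fun n : ℕ => stencilCore p n * ((n : ℝ) + 1) ^ (2 * p + 1)) (by
        intro n hn
        rw [Finset.mem_range] at hn
        have a1 : n ≠ 0 := by omega
        have a2 : n ≠ 1 := by omega
        simp [stencilCore, a1, a2])
    convert h3 using 1
    simp [Finset.sum_range_succ, stencilCore]
    norm_num
  have h3 := h1.add h2
  rw [zero_add] at h3
  refine h3.congr_fun fun n => ?_
  rw [stencil, add_mul, Finset.sum_mul]
  congr 1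
  refine Finset.sum_congr rfl fun l hl => ?_
  have := root_eulerRec_ne_zero (mem_innerRoots.1 hl).1
  rw [Int.natAbs_natCast]
  push_cast
  field_simp
  ring

lemma summable_stencil_mul_pow (p k : ℕ) :
    Summable (fun n : ℕ => stencil p n * (n : ℝ) ^ k) := by
  have h1 : Summable (fun n : ℕ => ∑ l ∈ innerRoots (2 * p),
      rootWeight p l * ((n : ℝ) ^ k * l ^ n)) :=
    summable_sum fun l hl =>
      Summable.mul_left (rootWeight p l)
        (summable_pow_mul_geometric_of_norm_lt_one (R := ℝ) k (mem_innerRoots.1 hl).2)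
  have h2 : Summable (fun n : ℕ => stencilCore p n * (n : ℝ) ^ k) := by
    refine summable_of_ne_finset_zero (s := Finset.range 2) fun n hn => ?_
    rw [Finset.mem_range] at hn
    have a1 : n ≠ 0 := by omega
    have a2 : n ≠ 1 := by omega
    simp [stencilCore, a1, a2]
  refine (h1.add h2).congr fun n => ?_
  rw [stencil, add_mul, Finset.sum_mul]
  congr 1
  refine Finset.sum_congr rfl fun l _ => ?_
  rw [Int.natAbs_natCast]
  ring

lemma hasSum_stencil_mul_even_pow {p q : ℕ} (hq : Odd q) (hqp : q ≤ 2 * p) :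
    HasSum (fun n : ℕ => stencil p n * (n : ℝ) ^ (q + 1)) 0 := by
  have h1 : HasSum (fun n : ℕ => ∑ l ∈ innerRoots (2 * p),
      rootWeight p l * ((n : ℝ) ^ (q + 1) * l ^ n)) (-1) := by
    rw [← sum_innerRoots hq hqp]
    refine hasSum_sum fun l hl => ?_
    have h := (hasSum_pow_mul_geometric_eulerRec q (mem_innerRoots.1 hl).2).mul_left
      (rootWeight p l)
    suffices e : rootWeight p l * (l * (eulerRec q).eval l / (1 - l) ^ (q + 2)) =
        (1 - l) ^ (2 * p + 1 - q) * (eulerRec q).eval l / (eulerRec (2 * p + 1)).eval l by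
      rwa [e] at h
    have hl := (mem_innerRoots.1 hl).1
    have a1 : 1 - l ≠ 0 := sub_ne_zero.2 (root_eulerRec_ne_one hl).symm
    have a2 := root_eulerRec_ne_zero hl
    have a3 := eval_succ_root_eulerRec_ne_zero hl
    rw [rootWeight, show 2 * p + 3 = (2 * p + 1 - q) + (q + 2) by omega, pow_add]
    field_simp
  have h2 : HasSum (fun n : ℕ => stencilCore p n * (n : ℝ) ^ (q + 1)) 1 := by
    have h3 := hasSum_single (f := fun n : ℕ => stencilCore p n * (n : ℝ) ^ (q + 1)) 1 (by
      intro n hn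
      rcases Nat.eq_zero_or_pos n with rfl | hn0
      · simp
      · simp [stencilCore, hn, hn0.ne'])
    simpa [stencilCore] using h3
  have h3 := h1.add h2
  rw [neg_add_cancel] at h3
  refine h3.congr_fun fun n => ?_
  rw [stencil, add_mul, Finset.sum_mul]
  congr 1
  refine Finset.sum_congr rfl fun l _ => ?_
  rw [Int.natAbs_natCast]
  ring

lemma hasSum_stencil_mul_int_pow {p k : ℕ} (hk0 : k ≠ 0) (hk : k ≤ 2 * p + 1) :
    HasSum (fun β : ℤ => stencil p β * (β : ℝ) ^ k) 0 := by
  obtain ⟨a, ha⟩ := summable_stencil_mul_pow p k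
  have hb : HasSum (fun n : ℕ => stencil p (-n) * (((-n : ℤ) : ℝ)) ^ k) ((-1) ^ k * a) := by
    refine (ha.mul_left ((-1) ^ k)).congr_fun fun n => ?_
    rw [stencil_neg]
    push_cast
    rw [neg_pow]
    ring
  have h := HasSum.of_nat_of_neg (f := fun β : ℤ => stencil p β * (β : ℝ) ^ k)
    (by simpa using ha) hb
  suffices h0 : a + (-1) ^ k * a - stencil p 0 * ((0 : ℤ) : ℝ) ^ k = 0 by rwa [h0] at h
  rcases Nat.even_or_odd k with he | ho
  · obtain ⟨q, rfl⟩ := Nat.exists_eq_succ_of_ne_zero hk0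
    have hq : Odd q := by simpa [Nat.even_add_one] using he
    rw [ha.unique (hasSum_stencil_mul_even_pow hq (by omega))]
    simp
  · simp [ho.neg_one_pow, hk0]

lemma hasSum_stencil_mul_sub_pow (p : ℕ) (x : ℝ) :
    HasSum (fun β : ℤ => stencil p β * (x - β) ^ (2 * p + 1)) 0 := by
  have hs := summable_stencil_mul_pow p 0
  obtain ⟨M, hM⟩ : Summable (stencil p) :=
    Summable.of_nat_of_neg (by simpa using hs) (by simpa [stencil_neg] using hs)
  have key : ∀ y : ℝ, HasSum (fun β : ℤ => stencil p β * (y - β) ^ (2 * p + 1))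
      (y ^ (2 * p + 1) * M) := by
    intro y
    have h1 := hasSum_sum (s := Finset.range (2 * p + 2)) (f := fun k (β : ℤ) =>
      (-1) ^ k * y ^ (2 * p + 1 - k) * ((2 * p + 1).choose k : ℝ) *
        (stencil p β * (β : ℝ) ^ k)) (a := fun k => if k = 0 then y ^ (2 * p + 1) * M else 0) (by
      intro k hk
      rw [Finset.mem_range] at hk
      split_ifs with h0
      · subst h0
        simpa using hM.mul_left (y ^ (2 * p + 1))
      · simpa using (hasSum_stencil_mul_int_pow h0 (by omega)).mul_left
          ((-1) ^ k * y ^ (2 * p + 1 - k) * ((2 * p + 1).choose k : ℝ)))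
    rw [Finset.sum_ite_eq' (Finset.range (2 * p + 2)) 0, if_pos (by simp)] at h1
    refine h1.congr_fun fun β => ?_
    rw [sub_eq_neg_add, add_pow, Finset.mul_sum]
    refine Finset.sum_congr rfl fun k _ => ?_
    rw [neg_pow]
    ring
  have hodd : Odd (2 * p + 1) := odd_two_mul_add_one p
  have h1 : HasSum (fun β : ℤ => stencil p (-β) * (1 - ((-β : ℤ) : ℝ)) ^ (2 * p + 1)) (0 + 0) := by
    refine HasSum.of_nat_of_neg_add_one ?_ ?_
    · refine (hasSum_stencil_mul_succ_pow p).congr_fun fun n => ?_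
      rw [stencil_neg]
      push_cast
      ring
    · have h2 := (hasSum_stencil_add_mul_pow p 1).neg
      rw [if_neg one_ne_zero, neg_zero] at h2
      refine h2.congr_fun fun n => ?_
      rw [stencil_neg, stencil_neg]
      push_cast
      rw [add_comm (n : ℤ) 1, show (1 - - -((n : ℝ) + 1)) = -n by ring, hodd.neg_pow]
      ring
  have h2 := ((Equiv.neg ℤ).hasSum_iff
    (f := fun β : ℤ => stencil p β * (1 - (β : ℝ)) ^ (2 * p + 1))).1 h1
  have h3 := h2.unique (key 1)
  have hM0 : M = 0 := by simpa using h3.symm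
  simpa [hM0] using key x

lemma hasSum_stencil_nat (p c : ℕ) :
    HasSum (fun β : ℤ => stencil p β *
      (((c - β : ℤ) : ℝ) ^ (2 * p + 1) * ((c - β : ℤ).sign : ℝ))) (2 * if c = 0 then 1 else 0) := by
  have hodd : Odd (2 * p + 1) := odd_two_mul_add_one p
  have h1 : HasSum (fun β : ℤ => if (c : ℤ) ≤ β then
      stencil p β * (β - c : ℝ) ^ (2 * p + 1) else 0) (if c = 0 then 1 else 0) := by
    have hi : Function.Injective (fun n : ℕ => (c : ℤ) + n) := fun a b h => by
      simpa using h
    refine (hi.hasSum_iff ?_).1 ?_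
    · intro β hβ
      refine if_neg fun hc => hβ ⟨(β - c).toNat, ?_⟩
      simp only
      omega
    · refine (hasSum_stencil_add_mul_pow p c).congr_fun fun n => ?_
      simp
  have h2 := (hasSum_stencil_mul_sub_pow p c).add (h1.mul_left 2)
  rw [zero_add] at h2
  refine h2.congr_fun fun β => ?_
  split_ifs with hc
  · rcases hc.eq_or_lt with rfl | hlt
    · simp
    · rw [Int.sign_eq_neg_one_of_neg (by omega)]
      push_cast
      rw [← neg_sub (β : ℝ) c, hodd.neg_pow]
      ring
  · rw [Int.sign_eq_one_of_pos (by omega)]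
    push_cast
    ring

lemma hasSum_stencil (p : ℕ) (γ : ℤ) :
    HasSum (fun β : ℤ => stencil p β *
      (((γ - β : ℤ) : ℝ) ^ (2 * p + 1) * ((γ - β : ℤ).sign : ℝ))) (2 * if γ = 0 then 1 else 0) := by
  obtain ⟨c, rfl | rfl⟩ := γ.eq_nat_or_neg
  · simpa using hasSum_stencil_nat p c
  · have hodd : Odd (2 * p + 1) := odd_two_mul_add_one p
    have h := (Equiv.neg ℤ).hasSum_iff.2 (hasSum_stencil_nat p c)
    simp only [neg_eq_zero, Nat.cast_eq_zero]
    refine h.congr_fun fun β => ?_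
    simp only [Function.comp_apply, Equiv.neg_apply, stencil_neg]
    rw [show (-(c : ℤ) - β) = -(c - -β) by ring, Int.sign_neg]
    push_cast
    rw [hodd.neg_pow]
    ring

end EulerFrobenius

theorem Dm_convolution_Gm (m : ℕ) (hm : 2 ≤ m) (h : ℝ) (hh : 0 < h) (γ : ℤ) :
    Summable (fun β : ℤ => Dm m h β * Gm m h (γ - β)) ∧
    h * ∑' β : ℤ, Dm m h β * Gm m h (γ - β) = (if γ = 0 then 1 else 0) := by
  obtain ⟨p, rfl⟩ : ∃ p, m = p + 1 := ⟨m - 1, by omega⟩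
  have h2 : HasSum (fun β : ℤ => Dm (p + 1) h β * Gm (p + 1) h (γ - β))
      (1 / (2 * h) * (2 * if γ = 0 then 1 else 0)) := by
    refine ((hasSum_stencil p γ).mul_left (1 / (2 * h))).congr_fun fun β => ?_
    have hf : ((2 * p + 1).factorial : ℝ) ≠ 0 := by positivity
    rw [Dm_eq_stencil, Gm, show 2 * (p + 1) - 1 = 2 * p + 1 by omega, mul_pow,
      show h ^ (2 * p + 2) = h ^ (2 * p + 1) * h by ring]
    field_simp
  refine ⟨h2.summable, ?_⟩
  rw [h2.tsum_eq]
  field_simp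
end

section
/- Let m ≥ 2 be an integer and h > 0. For every β ∈ ℤ one has the representation D_m[β] = ((2m-1)!/h^{2m}) · ∑_{j=-m}^{m} (-1)^{j+m} binom(2m, m+j) · ∑_{λ∈Λ} λ^{|β−j|+m−2}/E_{2m-2}'(λ), i.e. D_m is ((2m-1)!/h^{2m}) times the convolution of the symmetric difference Δ_2^{[m]}[β] = ∑_{j=-m}^{m} (-1)^{j+m} binom(2m, m+j) δ[β−j] with the function β ↦ ∑_{λ∈Λ} λ^{|β|+m−2}/E_{2m-2}'(λ). -/
open Polynomial

lemma eulerCoeff_zero_right (k : ℕ) : eulerCoeff k 0 = 1 := by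
  simp [eulerCoeff]

lemma eulerCoeff_one_right (k : ℕ) : eulerCoeff k 1 = 2 ^ (k + 1) - (k + 2) := by
  simp [eulerCoeff, Finset.sum_range_succ]
  ring

lemma eulerCoeff_succ (k s : ℕ) :
    eulerCoeff (k + 1) (s + 1) =
      (s + 2) * eulerCoeff k (s + 1) + (k + 1 - s) * eulerCoeff k s := by
  unfold eulerCoeff
  rw [Finset.sum_range_succ' _ (s + 1), Finset.sum_range_succ' _ (s + 1), mul_add, Finset.mul_sum,
    Finset.mul_sum, add_right_comm _ (((s : ℝ) + 2) * _), ← Finset.sum_add_distrib]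
  congr 1
  · refine Finset.sum_congr rfl fun j hj => ?_
    have hj' : j ≤ s := by simpa [Nat.lt_succ_iff] using hj
    have h1 : s + 1 + 1 - (j + 1) = s + 1 - j := by omega
    rw [h1, Nat.cast_sub (by omega)]
    have h2 : ((k + 3).choose (j + 1) : ℝ) = (k + 2).choose j + (k + 2).choose (j + 1) := by
      exact_mod_cast Nat.choose_succ_succ (k + 2) j
    have h3 : ((k + 2).choose (j + 1) : ℝ) * (j + 1) = (k + 2).choose j * (k + 2 - j) := by
      rcases le_or_gt j (k + 2) with h | h
      · have := Nat.choose_succ_right_eq (k + 2) j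
        have h4 := congrArg (Nat.cast (R := ℝ)) this
        push_cast [Nat.cast_sub h] at h4
        exact h4
      · simp [Nat.choose_eq_zero_of_lt h, Nat.choose_eq_zero_of_lt (show k + 2 < j + 1 by omega)]
    rw [show k + 1 + 2 = k + 3 from rfl, h2]
    push_cast
    linear_combination (-1) ^ (j) * ((s : ℝ) + 1 - j) ^ (k + 1) * h3
  · simp
    ring

lemma eulerCoeff_eq_zero {k s : ℕ} (h : k < s) : eulerCoeff k s = 0 := by
  induction k generalizing s with
  | zero =>
    obtain ⟨s, rfl⟩ : ∃ t, s = t + 1 := ⟨s - 1, by omega⟩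
    rcases s with _ | s
    · norm_num [eulerCoeff_one_right]
    · unfold eulerCoeff
      rw [Finset.sum_range_succ' _ _, Finset.sum_range_succ' _ _, Finset.sum_range_succ' _ _,
        Finset.sum_eq_zero]
      · simp
        ring
      · intro i _
        simp [Nat.choose_eq_zero_of_lt (show 2 < i + 1 + 1 + 1 by omega)]
  | succ k ih =>
    obtain ⟨s, rfl⟩ : ∃ t, s = t + 1 := ⟨s - 1, by omega⟩
    rw [eulerCoeff_succ, ih (by omega), ih (by omega)]
    ring

lemma eulerCoeff_symm {k i j : ℕ} (h : i + j = k) : eulerCoeff k i = eulerCoeff k j := by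
  induction k generalizing i j with
  | zero => rw [show i = j by omega]
  | succ k ih =>
    rcases i with _ | i <;> rcases j with _ | j
    · rfl
    · rw [eulerCoeff_succ, eulerCoeff_zero_right, eulerCoeff_eq_zero (by omega),
        ← ih (show 0 + j = k by omega), eulerCoeff_zero_right]
      have : (j : ℝ) = k := by exact_mod_cast (show j = k by omega)
      rw [this]; ring
    · rw [eulerCoeff_succ, eulerCoeff_zero_right, eulerCoeff_eq_zero (by omega),
        ← ih (show 0 + i = k by omega), eulerCoeff_zero_right]
      have : (i : ℝ) = k := by exact_mod_cast (show i = k by omega)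
      rw [this]; ring
    · rw [eulerCoeff_succ, eulerCoeff_succ, ih (show i + 1 + j = k by omega),
        ih (show i + (j + 1) = k by omega)]
      have : (k : ℝ) = i + j + 1 := by exact_mod_cast (show k = i + j + 1 by omega)
      rw [this]; ring

lemma coeff_eulerPoly (k n : ℕ) : (eulerPoly k).coeff n = eulerCoeff k n := by
  simp only [eulerPoly, finsetSum_coeff, coeff_C_mul, coeff_X_pow, mul_ite, mul_one, mul_zero,
    Finset.sum_ite_eq, Finset.mem_range]
  split_ifs with h
  · rfl
  · rw [eulerCoeff_eq_zero (by omega)]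

lemma eulerPoly_zero : eulerPoly 0 = 1 := by
  simp [eulerPoly, eulerCoeff_zero_right]

lemma coeff_eulerPoly_self (k : ℕ) : (eulerPoly k).coeff k = 1 := by
  rw [coeff_eulerPoly, eulerCoeff_symm (add_zero k), eulerCoeff_zero_right]

lemma natDegree_eulerPoly (k : ℕ) : (eulerPoly k).natDegree = k := by
  refine natDegree_eq_of_le_of_coeff_ne_zero ?_ (by simp [coeff_eulerPoly_self])
  refine natDegree_le_iff_coeff_eq_zero.2 fun n hn => ?_
  rw [coeff_eulerPoly, eulerCoeff_eq_zero hn]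

lemma monic_eulerPoly (k : ℕ) : (eulerPoly k).Monic := by
  rw [Monic, leadingCoeff, natDegree_eulerPoly, coeff_eulerPoly_self]

lemma eulerPoly_succ (k : ℕ) :
    eulerPoly (k + 1) =
      (1 + ((k : ℝ[X]) + 1) * X) * eulerPoly k + X * (1 - X) * derivative (eulerPoly k) := by
  rw [show (1 + ((k : ℝ[X]) + 1) * X) * eulerPoly k + X * (1 - X) * derivative (eulerPoly k) =
    eulerPoly k + X * (C ((k : ℝ) + 1) * eulerPoly k + derivative (eulerPoly k)
      - X * derivative (eulerPoly k)) by simp; ring]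
  ext n
  rcases n with _ | n
  · simp [coeff_eulerPoly, eulerCoeff_zero_right]
  · rw [coeff_add, coeff_X_mul, coeff_sub, coeff_add, coeff_C_mul, coeff_derivative]
    rcases n with _ | n
    · simp [coeff_eulerPoly, eulerCoeff_succ]; ring
    · rw [coeff_X_mul, coeff_derivative]
      simp only [coeff_eulerPoly, eulerCoeff_succ k (n + 1)]
      push_cast
      ring

lemma eval_one_eulerPoly_ne_zero (k : ℕ) : (eulerPoly k).eval 1 ≠ 0 := by
  induction k with
  | zero => simp [eulerPoly_zero]
  | succ k ih =>
    rw [eulerPoly_succ]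
    simp only [eval_add, eval_mul, eval_one, eval_natCast, eval_X, eval_sub, sub_self, mul_zero,
      zero_mul, add_zero, mul_one]
    exact mul_ne_zero (by positivity) ih

lemma eval_zero_eulerPoly (k : ℕ) : (eulerPoly k).eval 0 = 1 := by
  rw [← coeff_zero_eq_eval_zero, coeff_eulerPoly, eulerCoeff_zero_right]

lemma eval_inv_eulerPoly (k : ℕ) {x : ℝ} (hx : x ≠ 0) :
    x ^ k * (eulerPoly k).eval x⁻¹ = (eulerPoly k).eval x := by
  rw [eval_eq_sum_range, eval_eq_sum_range, natDegree_eulerPoly, Finset.mul_sum,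
    ← Finset.sum_range_reflect]
  refine Finset.sum_congr rfl fun i hi => ?_
  have hi' : i ≤ k := by simpa [Nat.lt_succ_iff] using hi
  rw [show k + 1 - 1 - i = k - i by omega, coeff_eulerPoly, coeff_eulerPoly,
    eulerCoeff_symm (show k - i + i = k by omega), inv_pow, ← pow_sub_mul_pow x hi']
  field_simp

lemma eval_derivative_eulerPoly (k : ℕ) {x : ℝ} (hx : x ≠ 0)
    (h : (eulerPoly (k + 2)).eval x = 0) :
    (derivative (eulerPoly (k + 2))).eval x =
      -(x ^ k * (derivative (eulerPoly (k + 2))).eval x⁻¹) := by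
  have h0 : (eulerPoly (k + 2)).eval x⁻¹ = 0 := by
    have := eval_inv_eulerPoly (k + 2) hx
    rw [h] at this
    exact (mul_eq_zero.1 this).resolve_left (pow_ne_zero _ hx)
  have h1 := (hasDerivAt_pow (k + 2) x).mul
    (((eulerPoly (k + 2)).hasDerivAt x⁻¹).comp x (hasDerivAt_inv hx))
  have h2 := ((eulerPoly (k + 2)).hasDerivAt x).congr_of_eventuallyEq
    (f₁ := (fun y => y ^ (k + 2)) * ((fun y => (eulerPoly (k + 2)).eval y) ∘ Inv.inv)) (by
      filter_upwards [isOpen_ne.mem_nhds hx] with y hy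
      exact eval_inv_eulerPoly (k + 2) hy)
  rw [← h1.unique h2]
  simp only [Function.comp, h0]
  field_simp
  ring

/-- The polynomials obtained from `x * E_k(x) / (1 - x) ^ (k + 2)` by the substitution
`u = 1 / (1 - x)`. -/
noncomputable def substPoly : ℕ → Polynomial ℝ
  | 0 => X * (X - 1)
  | k + 1 => X * (X - 1) * derivative (substPoly k)

lemma eval_substPoly (k : ℕ) {u : ℝ} (hu : u ≠ 0) :
    (substPoly k).eval u = u ^ (k + 1) * (u - 1) * (eulerPoly k).eval (1 - u⁻¹) := by
  induction k generalizing u with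
  | zero => simp [substPoly, eulerPoly_zero]
  | succ k ih =>
    have h1 := ((hasDerivAt_pow (k + 1) u).mul ((hasDerivAt_id u).sub_const 1)).mul
      (((eulerPoly k).hasDerivAt (1 - u⁻¹)).comp u ((hasDerivAt_inv hu).const_sub 1))
    have h2 := h1.congr_of_eventuallyEq (f₁ := fun y => (substPoly k).eval y) (by
      filter_upwards [isOpen_ne.mem_nhds hu] with y hy
      exact ih hy)
    have h3 := ((substPoly k).hasDerivAt u).unique h2
    simp only [substPoly, eval_mul, h3, eulerPoly_succ, eval_add, eval_X, eval_sub, eval_one,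
      eval_natCast]
    simp only [Function.comp, Pi.mul_apply, id]
    generalize (eulerPoly k).eval (1 - u⁻¹) = a
    generalize (derivative (eulerPoly k)).eval (1 - u⁻¹) = b
    push_cast
    field_simp
    ring

lemma eval_zero_substPoly (k : ℕ) : (substPoly k).eval 0 = 0 := by
  cases k <;> simp [substPoly]

lemma eval_one_substPoly (k : ℕ) : (substPoly k).eval 1 = 0 := by
  cases k <;> simp [substPoly]

lemma substPoly_ne_zero (k : ℕ) : substPoly k ≠ 0 := by
  have hX : (X * (X - 1) : ℝ[X]) ≠ 0 :=
    mul_ne_zero X_ne_zero (by simpa using X_sub_C_ne_zero (1 : ℝ))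
  induction k with
  | zero => exact hX
  | succ k ih =>
    refine mul_ne_zero hX fun h => ih ?_
    have h1 := eq_C_of_natDegree_eq_zero (derivative_eq_zero.1 h)
    rw [h1, coeff_zero_eq_eval_zero, eval_zero_substPoly, C_0]

lemma card_roots_substPoly (k : ℕ) : k + 2 ≤ (substPoly k).roots.toFinset.card := by
  have hmem : ∀ k (x : ℝ), x = 0 ∨ x = 1 → x ∈ (substPoly k).roots.toFinset := by
    intro k x hx
    rw [Multiset.mem_toFinset, mem_roots (substPoly_ne_zero k)]
    rcases hx with rfl | rfl
    · exact eval_zero_substPoly k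
    · exact eval_one_substPoly k
  induction k with
  | zero =>
    have : ({0, 1} : Finset ℝ) ⊆ (substPoly 0).roots.toFinset := by
      intro x hx
      exact hmem 0 x (by simpa using hx)
    simpa using Finset.card_le_card this
  | succ k ih =>
    have h1 := card_roots_toFinset_le_card_roots_derivative_sdiff_roots_succ (substPoly k)
    have h2 : ({0, 1} : Finset ℝ) ∪
        ((derivative (substPoly k)).roots.toFinset \ (substPoly k).roots.toFinset) ⊆
        (substPoly (k + 1)).roots.toFinset := by
      intro x hx
      rw [Finset.mem_union] at hx
      rcases hx with hx | hx
      · exact hmem _ x (by simpa using hx)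
      · rw [Finset.mem_sdiff, Multiset.mem_toFinset] at hx
        rw [Multiset.mem_toFinset, mem_roots (substPoly_ne_zero _)]
        have := isRoot_of_mem_roots hx.1
        simp only [IsRoot.def] at this
        simp [substPoly, this]
    have h3 : Disjoint ({0, 1} : Finset ℝ)
        ((derivative (substPoly k)).roots.toFinset \ (substPoly k).roots.toFinset) := by
      rw [Finset.disjoint_left]
      intro x hx hx'
      exact (Finset.mem_sdiff.1 hx').2 (hmem k x (by simpa using hx))
    have h4 := Finset.card_le_card h2
    rw [Finset.card_union_of_disjoint h3, Finset.card_pair (by norm_num)] at h4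
    omega

lemma card_roots_eulerPoly (k : ℕ) : (eulerPoly k).roots.toFinset.card = k := by
  refine le_antisymm ((Multiset.toFinset_card_le _).trans
    ((card_roots' _).trans (natDegree_eulerPoly k).le)) ?_
  have h : ((substPoly k).roots.toFinset \ {0, 1}).image (fun u : ℝ => 1 - u⁻¹) ⊆
      (eulerPoly k).roots.toFinset := by
    intro x hx
    obtain ⟨u, hu, rfl⟩ := Finset.mem_image.1 hx
    simp only [Finset.mem_sdiff, Multiset.mem_toFinset, Finset.mem_insert,
      Finset.mem_singleton, not_or] at hu
    have h1 := isRoot_of_mem_roots hu.1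
    rw [IsRoot.def, eval_substPoly k hu.2.1] at h1
    rw [Multiset.mem_toFinset, mem_roots (monic_eulerPoly k).ne_zero]
    exact (mul_eq_zero.1 h1).resolve_left
      (mul_ne_zero (pow_ne_zero _ hu.2.1) (sub_ne_zero.2 hu.2.2))
  have h1 := Finset.card_le_card h
  rw [Finset.card_image_of_injective _ (fun a b hab => by simpa using hab)] at h1
  have h2 := Finset.le_card_sdiff ({0, 1} : Finset ℝ) (substPoly k).roots.toFinset
  rw [Finset.card_pair (by norm_num)] at h2
  have := card_roots_substPoly k
  omega

lemma nodal_roots_eulerPoly (k : ℕ) :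
    Lagrange.nodal (eulerPoly k).roots.toFinset id = eulerPoly k := by
  have h : (eulerPoly k).roots.card ≤ (eulerPoly k).roots.toFinset.card := by
    rw [card_roots_eulerPoly]
    exact (card_roots' _).trans (natDegree_eulerPoly k).le
  have hn : (eulerPoly k).roots.Nodup := by
    rw [← Multiset.dedup_eq_self]
    exact Multiset.eq_of_le_of_card_le (Multiset.dedup_le _) h
  rw [Lagrange.nodal_eq, Finset.prod, Multiset.toFinset_val, hn.dedup]
  refine prod_multiset_X_sub_C_of_monic_of_roots_card_eq (monic_eulerPoly k) ?_
  rw [natDegree_eulerPoly]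
  refine le_antisymm ((card_roots' _).trans (natDegree_eulerPoly k).le) ?_
  exact (card_roots_eulerPoly k).ge.trans (Multiset.toFinset_card_le _)

lemma eval_derivative_eulerPoly_eq_prod {k : ℕ} {r : ℝ}
    (hr : r ∈ (eulerPoly k).roots.toFinset) :
    (derivative (eulerPoly k)).eval r =
      ∏ s ∈ (eulerPoly k).roots.toFinset.erase r, (r - s) := by
  conv_lhs => rw [← nodal_roots_eulerPoly k]
  have := Lagrange.eval_nodal_derivative_eval_node_eq (v := id) hr
  simp only [id] at this
  rw [this, Lagrange.eval_nodal]
  rfl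

lemma eval_derivative_eulerPoly_ne_zero {k : ℕ} {r : ℝ}
    (hr : r ∈ (eulerPoly k).roots.toFinset) : (derivative (eulerPoly k)).eval r ≠ 0 := by
  rw [eval_derivative_eulerPoly_eq_prod hr, Finset.prod_ne_zero_iff]
  exact fun s hs => sub_ne_zero.2 (Finset.ne_of_mem_erase hs).symm

lemma sum_eval_div_derivative_eulerPoly {k : ℕ} {P : ℝ[X]} (hP : P.degree < k) :
    ∑ r ∈ (eulerPoly k).roots.toFinset, P.eval r / (derivative (eulerPoly k)).eval r =
      P.coeff (k - 1) := by
  have h := Lagrange.coeff_eq_sum (s := (eulerPoly k).roots.toFinset) (v := id)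
    Function.injective_id.injOn (P := P) (by rwa [card_roots_eulerPoly])
  rw [card_roots_eulerPoly] at h
  rw [h]
  exact Finset.sum_congr rfl fun r hr => by rw [eval_derivative_eulerPoly_eq_prod hr]; rfl

lemma sum_pow_div_derivative_eulerPoly {k p : ℕ} (hp : p < k) :
    ∑ r ∈ (eulerPoly k).roots.toFinset, r ^ p / (derivative (eulerPoly k)).eval r =
      if p + 1 = k then 1 else 0 := by
  have h := sum_eval_div_derivative_eulerPoly (k := k) (P := X ^ p)
    (by rw [degree_X_pow]; exact_mod_cast hp)
  simp only [eval_pow, eval_X, coeff_X_pow] at h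
  rw [h]
  exact if_congr (by omega) rfl rfl

lemma sum_pow_self_div_derivative_eulerPoly (k : ℕ) :
    ∑ r ∈ (eulerPoly (k + 1)).roots.toFinset,
      r ^ (k + 1) / (derivative (eulerPoly (k + 1))).eval r = k + 3 - 2 ^ (k + 2) := by
  have hd : (X ^ (k + 1) - eulerPoly (k + 1)).degree < ((k + 1 : ℕ) : WithBot ℕ) := by
    have hE : (eulerPoly (k + 1)).degree = ((k + 1 : ℕ) : WithBot ℕ) := by
      rw [degree_eq_natDegree (monic_eulerPoly _).ne_zero, natDegree_eulerPoly]
    have := degree_sub_lt_left (p := X ^ (k + 1)) (q := eulerPoly (k + 1))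
      (by rw [degree_X_pow, hE]) (pow_ne_zero _ X_ne_zero)
      (by rw [(monic_X_pow _).leadingCoeff, (monic_eulerPoly _).leadingCoeff])
    rwa [degree_X_pow] at this
  have h := sum_eval_div_derivative_eulerPoly hd
  rw [Nat.add_sub_cancel, coeff_sub, coeff_X_pow, if_neg (by omega), coeff_eulerPoly,
    eulerCoeff_symm rfl, eulerCoeff_one_right] at h
  rw [show (k : ℝ) + 3 - 2 ^ (k + 2) = 0 - (2 ^ (k + 1 + 1) - ((k + 1 : ℕ) + 2)) by
    push_cast; ring, ← h]
  refine Finset.sum_congr rfl fun r hr => ?_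
  rw [Multiset.mem_toFinset] at hr
  rw [eval_sub, (isRoot_of_mem_roots hr).eq_zero, eval_pow, eval_X, sub_zero]

lemma mem_roots_eulerPoly {k : ℕ} {r : ℝ} :
    r ∈ (eulerPoly k).roots.toFinset ↔ (eulerPoly k).eval r = 0 := by
  rw [Multiset.mem_toFinset, mem_roots (monic_eulerPoly k).ne_zero, IsRoot.def]

lemma ne_zero_of_eval_eulerPoly {k : ℕ} {r : ℝ} (hr : (eulerPoly k).eval r = 0) : r ≠ 0 := by
  rintro rfl
  simp [eval_zero_eulerPoly] at hr

lemma ne_one_of_eval_eulerPoly {k : ℕ} {r : ℝ} (hr : (eulerPoly k).eval r = 0) : r ≠ 1 := by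
  rintro rfl
  exact eval_one_eulerPoly_ne_zero k hr

lemma eval_inv_eulerPoly_eq_zero {k : ℕ} {r : ℝ} (hr : (eulerPoly k).eval r = 0) :
    (eulerPoly k).eval r⁻¹ = 0 := by
  have hr0 := ne_zero_of_eval_eulerPoly hr
  rw [← eval_inv_eulerPoly k hr0] at hr
  exact (mul_eq_zero.1 hr).resolve_left (pow_ne_zero _ hr0)

lemma abs_ne_one_of_eval_eulerPoly {n : ℕ} {r : ℝ} (hr : (eulerPoly (2 * n + 2)).eval r = 0) :
    |r| ≠ 1 := by
  intro h
  rcases (abs_eq zero_le_one).1 h with rfl | rfl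
  · exact ne_one_of_eval_eulerPoly hr rfl
  · have h1 := eval_derivative_eulerPoly (2 * n) (by norm_num) hr
    rw [inv_neg_one, Even.neg_one_pow (even_two_mul n)] at h1
    exact eval_derivative_eulerPoly_ne_zero (mem_roots_eulerPoly.2 hr) (by linarith)

lemma mem_smallRoots {n : ℕ} {r : ℝ} :
    r ∈ smallRoots (n + 2) ↔ (eulerPoly (2 * n + 2)).eval r = 0 ∧ |r| < 1 := by
  rw [smallRoots, Finset.mem_filter, show 2 * (n + 2) - 2 = 2 * n + 2 by omega,
    mem_roots_eulerPoly]

lemma sum_roots_eulerPoly (n : ℕ) (f : ℝ → ℝ) :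
    ∑ r ∈ (eulerPoly (2 * n + 2)).roots.toFinset, f r =
      ∑ l ∈ smallRoots (n + 2), (f l + f l⁻¹) := by
  rw [Finset.sum_add_distrib, ← Finset.sum_filter_add_sum_filter_not _ (fun x : ℝ => |x| < 1)]
  congr 1
  refine Finset.sum_nbij' (fun r => r⁻¹) (fun r => r⁻¹) ?_ ?_ (by simp) (by simp) (by simp)
  · intro r hr
    rw [Finset.mem_filter, mem_roots_eulerPoly, not_lt] at hr
    rw [mem_smallRoots, abs_inv]
    exact ⟨eval_inv_eulerPoly_eq_zero hr.1,
      inv_lt_one_of_one_lt₀ (hr.2.lt_of_ne (abs_ne_one_of_eval_eulerPoly hr.1).symm)⟩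
  · intro r hr
    rw [mem_smallRoots] at hr
    rw [Finset.mem_filter, mem_roots_eulerPoly, not_lt, abs_inv]
    exact ⟨eval_inv_eulerPoly_eq_zero hr.1, (one_le_inv₀
      (abs_pos.2 (ne_zero_of_eval_eulerPoly hr.1))).2 hr.2.le⟩

/-- The function `t ↦ ∑ λ ^ (t + n) / E_{2n+2}'(λ)` on the integers, where the sum runs over the
roots of modulus less than `1`. -/
noncomputable def rootSum (n : ℕ) (t : ℤ) : ℝ :=
  ∑ l ∈ smallRoots (n + 2), l ^ (t + n) / (derivative (eulerPoly (2 * n + 2))).eval l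

lemma rootSum_sub_rootSum_neg (n t : ℕ) :
    rootSum n t - rootSum n (-t) =
      ∑ r ∈ (eulerPoly (2 * n + 2)).roots.toFinset,
        r ^ (t + n) / (derivative (eulerPoly (2 * n + 2))).eval r := by
  rw [sum_roots_eulerPoly, rootSum, rootSum, ← Finset.sum_sub_distrib]
  refine Finset.sum_congr rfl fun l hl => ?_
  rw [mem_smallRoots] at hl
  have hl0 := ne_zero_of_eval_eulerPoly hl.1
  rw [eval_derivative_eulerPoly (2 * n) hl0 hl.1, sub_eq_add_neg]
  congr 1
  rw [zpow_add₀ hl0, zpow_neg, zpow_natCast, zpow_natCast, inv_pow, pow_add, two_mul, pow_add]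
  field_simp

lemma rootSum_natAbs (n b i : ℕ) :
    rootSum n ((b - (n + 2) + i : ℤ).natAbs : ℤ) = rootSum n (b - (n + 2) + i) +
      (if b + i = 0 then 2 * n + 4 - 2 ^ (2 * n + 3) else if b + i = 1 then 1 else 0 : ℝ) := by
  rcases le_or_gt (n + 2) (b + i) with h | h
  · rw [if_neg (by omega), if_neg (by omega), add_zero]
    congr 1
    omega
  · obtain ⟨t, ht⟩ := Nat.exists_eq_add_of_lt h
    have h1 : (b - (n + 2) + i : ℤ) = -((t + 1 : ℕ) : ℤ) := by push_cast; omega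
    rw [h1, Int.natAbs_neg, Int.natAbs_natCast, ← sub_eq_iff_eq_add', rootSum_sub_rootSum_neg]
    split_ifs with h2 h3
    · rw [show t + 1 + n = 2 * n + 1 + 1 by omega]
      rw [sum_pow_self_div_derivative_eulerPoly]
      push_cast
      ring
    · rw [sum_pow_div_derivative_eulerPoly (by omega), if_pos (by omega)]
    · rw [sum_pow_div_derivative_eulerPoly (by omega), if_neg (by omega)]

lemma sum_choose_mul_rootSum (n b : ℕ) :
    ∑ i ∈ Finset.range (2 * (n + 2) + 1),
      (-1 : ℝ) ^ i * ((2 * (n + 2)).choose i : ℝ) * rootSum n (b - (n + 2) + i) =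
    ∑ l ∈ smallRoots (n + 2), (1 - l) ^ (2 * (n + 2)) * l ^ (b - 2 : ℤ) /
      (derivative (eulerPoly (2 * n + 2))).eval l := by
  simp only [rootSum, Finset.mul_sum]
  rw [Finset.sum_comm]
  refine Finset.sum_congr rfl fun l hl => ?_
  have hl0 := ne_zero_of_eval_eulerPoly (mem_smallRoots.1 hl).1
  rw [show 1 - l = -l + 1 by ring, add_pow, Finset.sum_mul, Finset.sum_div]
  refine Finset.sum_congr rfl fun i _ => ?_
  rw [show (b - (n + 2) + i + n : ℤ) = i + (b - 2) by ring, zpow_add₀ hl0, zpow_natCast,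
    neg_pow l]
  ring

lemma sum_choose_mul_ite (N b : ℕ) (x : ℝ) :
    ∑ i ∈ Finset.range (N + 2), (-1 : ℝ) ^ i * ((N + 1).choose i : ℝ) *
      (if b + i = 0 then x else if b + i = 1 then 1 else 0) =
    if b = 0 then x - (N + 1) else if b = 1 then 1 else 0 := by
  rw [Finset.sum_range_succ', Finset.sum_range_succ', Finset.sum_eq_zero]
  · rcases b with _ | _ | b
    · simp
      ring
    · simp
    · simp
  · intro i _
    rw [if_neg (by omega), if_neg (by omega), mul_zero]

lemma sum_Icc_eq_sum_range (m : ℕ) (β : ℤ) (g : ℕ → ℝ) :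
    ∑ j ∈ Finset.Icc (-(m : ℤ)) (m : ℤ),
      (-1 : ℝ) ^ (j + m).toNat * (Nat.choose (2 * m) (m + j).toNat : ℝ) * g (β - j).natAbs =
    ∑ i ∈ Finset.range (2 * m + 1),
      (-1 : ℝ) ^ i * ((2 * m).choose i : ℝ) * g (β.natAbs - m + i : ℤ).natAbs := by
  rcases le_total 0 β with h | h
  · refine Finset.sum_nbij' (fun j => (m - j).toNat) (fun i => m - i) ?_ ?_ ?_ ?_ ?_
    · intro j hj
      rw [Finset.mem_Icc] at hj
      rw [Finset.mem_range]
      omega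
    · intro i hi
      rw [Finset.mem_range] at hi
      rw [Finset.mem_Icc]
      omega
    · intro j hj
      rw [Finset.mem_Icc] at hj
      omega
    · intro i hi
      omega
    · intro j hj
      rw [Finset.mem_Icc] at hj
      obtain ⟨i, hi⟩ : ∃ i : ℕ, (m - j) = i := ⟨(m - j).toNat, by omega⟩
      have hi' : i ≤ 2 * m := by omega
      rw [hi, Int.toNat_natCast, show (j + m).toNat = 2 * m - i by omega,
        show (m + j).toNat = 2 * m - i by omega, Nat.choose_symm hi',
        show (β - j).natAbs = (β.natAbs - m + i : ℤ).natAbs by omega]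
      congr 2
      exact neg_one_pow_congr (by simp [Nat.even_sub hi'])
  · refine Finset.sum_nbij' (fun j => (m + j).toNat) (fun i => i - m) ?_ ?_ ?_ ?_ ?_
    · intro j hj
      rw [Finset.mem_Icc] at hj
      rw [Finset.mem_range]
      omega
    · intro i hi
      rw [Finset.mem_range] at hi
      rw [Finset.mem_Icc]
      omega
    · intro j hj
      rw [Finset.mem_Icc] at hj
      omega
    · intro i hi
      omega
    · intro j hj
      rw [Finset.mem_Icc] at hj
      obtain ⟨i, hi⟩ : ∃ i : ℕ, (m + j) = i := ⟨(m + j).toNat, by omega⟩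
      rw [add_comm j, hi, Int.toNat_natCast,
        show (β - j).natAbs = (β.natAbs - m + i : ℤ).natAbs by omega]

lemma eval_eulerPoly_succ_of_root {k : ℕ} {r : ℝ} (hr : (eulerPoly k).eval r = 0) :
    (eulerPoly (k + 1)).eval r = r * (1 - r) * (derivative (eulerPoly k)).eval r := by
  simp [eulerPoly_succ, hr]

lemma smallRoots_term_eq {n : ℕ} (b : ℕ) {l : ℝ} (hl : l ∈ smallRoots (n + 2)) :
    (1 - l) ^ (2 * (n + 2) + 1) * l ^ b / (l * (eulerPoly (2 * n + 3)).eval l) =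
      (1 - l) ^ (2 * (n + 2)) * l ^ (b - 2 : ℤ) /
        (derivative (eulerPoly (2 * n + 2))).eval l := by
  have hr := (mem_smallRoots.1 hl).1
  have hl0 := ne_zero_of_eval_eulerPoly hr
  have hl1 : 1 - l ≠ 0 := sub_ne_zero.2 (ne_one_of_eval_eulerPoly hr).symm
  have hl2 := eval_derivative_eulerPoly_ne_zero (mem_roots_eulerPoly.2 hr)
  rw [eval_eulerPoly_succ_of_root hr, zpow_sub₀ hl0, zpow_natCast, pow_succ (1 - l)]
  norm_cast
  field_simp

lemma Dm_eq (n : ℕ) (h : ℝ) (β : ℤ) :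
    Dm (n + 2) h β = (((2 * (n + 2) - 1).factorial : ℝ) / h ^ (2 * (n + 2))) *
      (∑ l ∈ smallRoots (n + 2), (1 - l) ^ (2 * (n + 2)) * l ^ (β.natAbs - 2 : ℤ) /
        (derivative (eulerPoly (2 * n + 2))).eval l +
      if β.natAbs = 0 then -(2 : ℝ) ^ (2 * n + 3) else if β.natAbs = 1 then 1 else 0) := by
  rw [Dm, ← Finset.sum_congr rfl fun l hl => smallRoots_term_eq β.natAbs hl,
    show 2 * (n + 2) - 1 = 2 * n + 3 by omega]
  congr 1
  by_cases h0 : β = 0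
  · subst h0
    simp [add_comm]
  · rw [if_neg h0, if_neg (Int.natAbs_ne_zero.2 h0)]
    split_ifs with h1
    · rw [add_comm, h1]
      congr 1
      refine Finset.sum_congr rfl fun l hl => ?_
      have hl0 := ne_zero_of_eval_eulerPoly (mem_smallRoots.1 hl).1
      rw [pow_one, mul_comm _ l, mul_div_mul_left _ _ hl0]
    · rw [add_zero]

theorem Dm_eq_symm_diff_convolution (m : ℕ) (hm : 2 ≤ m) (h : ℝ) (hh : 0 < h) (β : ℤ) :
    Dm m h β =
      (((2 * m - 1).factorial : ℝ) / h ^ (2 * m)) *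
        ∑ j ∈ Finset.Icc (-(m : ℤ)) (m : ℤ),
          (-1 : ℝ) ^ (j + m).toNat * (Nat.choose (2 * m) (m + j).toNat : ℝ) *
            ∑ l ∈ smallRoots m,
              l ^ ((β - j).natAbs + m - 2) /
                (Polynomial.derivative (eulerPoly (2 * m - 2))).eval l := by
  obtain ⟨n, rfl⟩ := Nat.exists_eq_add_of_le' hm
  have hG : ∀ j : ℤ, ∑ l ∈ smallRoots (n + 2), l ^ ((β - j).natAbs + (n + 2) - 2) /
      (derivative (eulerPoly (2 * (n + 2) - 2))).eval l =
        rootSum n ((β - j).natAbs : ℤ) := by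
    intro j
    refine Finset.sum_congr rfl fun l _ => ?_
    rw [show (β - j).natAbs + (n + 2) - 2 = (β - j).natAbs + n by omega,
      show 2 * (n + 2) - 2 = 2 * n + 2 by omega]
    norm_cast
  simp only [hG]
  rw [Dm_eq, sum_Icc_eq_sum_range (n + 2) β (fun a => rootSum n (a : ℤ))]
  simp only [Nat.cast_add, Nat.cast_ofNat, rootSum_natAbs, mul_add _ (rootSum _ _)]
  rw [Finset.sum_add_distrib, sum_choose_mul_rootSum]
  congr 2
  refine Eq.trans ?_ (sum_choose_mul_ite (2 * n + 3) β.natAbs _).symm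
  congr 1
  push_cast
  ring
end
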